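/- Let h = ℝ⁸ with basis (e₁,…,e₈) and Lie bracket determined by the non-vanishing relations [e₁,e₂] = −4√3 e₃, [e₁,e₃] = √(5/2) e₄, [e₁,e₄] = −2√3 e₈, [e₁,e₅] = 3√(7/2) e₆, [e₁,e₆] = −4√2 e₇, [e₂,e₃] = −√(5/2) e₅, [e₂,e₄] = −3√(7/2) e₆, [e₂,e₅] = −2√3 e₇, [e₂,e₆] = −4√2 e₈, [e₃,e₄] = −√21 e₇, [e₃,e₅] = −√21 e₈, and let ⟨·,·⟩ be the Lorentzian inner product for which (e₁,…,e₈) is orthonormal with ⟨e₆,e₆⟩ = −1. Then h is a nilpotent Lie algebra whose center is Z(h) = span{e₇, e₈}, which is nondegenerate with respect to ⟨·,·⟩, and (h,⟨·,·⟩) is λ-Einstein for some λ ≠ 0. -/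

import Mathlib

open Module LinearMap

noncomputable section

section OrthonormalBasis

variable {ι V : Type*} [Fintype ι] [DecidableEq ι] [AddCommGroup V] [Module ℝ V]
  (b : Basis ι ℝ V) (B : V →ₗ[ℝ] V →ₗ[ℝ] ℝ) (ε : ι → ℝ)

theorem bilin_basis_right_of_orthogonal
    (hB : ∀ i j, B (b i) (b j) = if i = j then ε i else 0) (x : V) (i : ι) :
    B x (b i) = ε i * b.repr x i := by
  conv_lhs => rw [← b.sum_repr x]
  simp [hB, mul_comm, -Basis.sum_repr]

theorem bilin_eq_sum_repr_of_orthogonal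
    (hB : ∀ i j, B (b i) (b j) = if i = j then ε i else 0) (x y : V) :
    B x y = ∑ i, ε i * b.repr x i * b.repr y i := by
  conv_lhs => rw [← b.sum_repr y]
  simp only [map_sum, map_smul, smul_eq_mul, bilin_basis_right_of_orthogonal b B ε hB]
  exact Finset.sum_congr rfl fun i _ => by ring

theorem trace_eq_sum_bilin_of_orthonormal
    (hB : ∀ i j, B (b i) (b j) = if i = j then ε i else 0) (hε : ∀ i, ε i * ε i = 1)
    (f : Module.End ℝ V) :
    LinearMap.trace ℝ V f = ∑ i, ε i * B (f (b i)) (b i) := by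
  rw [LinearMap.trace_eq_matrix_trace ℝ b, Matrix.trace]
  refine Finset.sum_congr rfl fun i _ => ?_
  rw [bilin_basis_right_of_orthogonal b B ε hB, ← mul_assoc, hε, one_mul, Matrix.diag_apply,
    LinearMap.toMatrix_apply]

end OrthonormalBasis

section TraceFormulas

variable {ι H : Type*} [Fintype ι] [DecidableEq ι] [LieRing H] [LieAlgebra ℝ H]
  (b : Basis ι ℝ H) (B : H →ₗ[ℝ] H →ₗ[ℝ] ℝ) (ε : ι → ℝ)

theorem trace_ad_comp_adjoint
    (hB : ∀ i j, B (b i) (b j) = if i = j then ε i else 0) (hε : ∀ i, ε i * ε i = 1)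
    (u v : H) (f : Module.End ℝ H) (hf : ∀ x w, B (f x) w = B x ⁅v, w⁆) :
    LinearMap.trace ℝ H ((LieAlgebra.ad ℝ H u : Module.End ℝ H) ∘ₗ f) =
      ∑ i, ε i * B ⁅u, b i⁆ ⁅v, b i⁆ := by
  have := Module.Finite.of_basis b
  have := Module.Free.of_basis b
  rw [LinearMap.trace_comp_comm', trace_eq_sum_bilin_of_orthonormal b B ε hB hε]
  simp [hf]

theorem trace_comp_of_bilin_lie
    (hB : ∀ i j, B (b i) (b j) = if i = j then ε i else 0) (hε : ∀ i, ε i * ε i = 1)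
    (u v : H) (f g : Module.End ℝ H) (hf : ∀ x w, B (f x) w = B u ⁅x, w⁆)
    (hg : ∀ x w, B (g x) w = B v ⁅x, w⁆) :
    LinearMap.trace ℝ H (f ∘ₗ g) =
      -∑ i, ∑ j, ε i * ε j * B u ⁅b i, b j⁆ * B v ⁅b i, b j⁆ := by
  rw [trace_eq_sum_bilin_of_orthonormal b B ε hB hε, ← Finset.sum_neg_distrib]
  refine Finset.sum_congr rfl fun i _ => ?_
  have hrepr (h : Module.End ℝ H) (j : ι) : b.repr (h (b i)) j = ε j * B (h (b i)) (b j) := by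
    rw [bilin_basis_right_of_orthogonal b B ε hB, ← mul_assoc, hε, one_mul]
  rw [LinearMap.comp_apply, hf, ← lie_skew, map_neg, ← hf,
    bilin_eq_sum_repr_of_orthogonal b B ε hB, mul_neg, Finset.mul_sum]
  congr 1
  refine Finset.sum_congr rfl fun j _ => ?_
  rw [hrepr, hrepr, hf, hg]
  linear_combination (ε i * ε j * B u ⁅b i, b j⁆ * B v ⁅b i, b j⁆) * hε j

end TraceFormulas

theorem lowerCentralSeries_repr_eq_zero {n : ℕ} {H : Type*} [LieRing H] [LieAlgebra ℝ H]
    (b : Basis (Fin n) ℝ H)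
    (hb : ∀ (u v : H) (i : Fin n), (∀ j < i, b.repr v j = 0) → b.repr ⁅u, v⁆ i = 0) (k : ℕ) :
    ∀ x ∈ LieModule.lowerCentralSeries ℝ H H k, ∀ i : Fin n, (i : ℕ) < k → b.repr x i = 0 := by
  induction k with
  | zero => intro x _ i hi; omega
  | succ k ih =>
    intro x hx i hi
    rw [LieModule.lowerCentralSeries_succ, ← LieSubmodule.mem_toSubmodule,
      LieSubmodule.lieIdeal_oper_eq_linear_span'] at hx
    refine Submodule.span_induction (p := fun x _ => b.repr x i = 0) ?_ ?_ ?_ ?_ hx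
    · rintro _ ⟨u, -, v, hv, rfl⟩
      exact hb u v i fun j hj => ih v hv j (by omega)
    · simp
    · intro x y _ _ hx hy
      simp [hx, hy]
    · intro c x _ hx
      simp [hx]

theorem lowerCentralSeries_eq_bot_of_repr_lie {n : ℕ} {H : Type*} [LieRing H] [LieAlgebra ℝ H]
    (b : Basis (Fin n) ℝ H)
    (hb : ∀ (u v : H) (i : Fin n), (∀ j < i, b.repr v j = 0) → b.repr ⁅u, v⁆ i = 0) :
    LieModule.lowerCentralSeries ℝ H H n = ⊥ := by
  rw [LieSubmodule.eq_bot_iff]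
  intro x hx
  exact b.ext_elem fun i => by
    simpa using lowerCentralSeries_repr_eq_zero b hb n x hx i i.isLt

set_option maxHeartbeats 2000000 in
/-- The 8-dimensional nilpotent Lie algebra of Conti–Rossi, with the
Lorentzian metric making the given basis orthonormal with `⟨e₆,e₆⟩ = −1`, has nondegenerate
center `span{e₇,e₈}` and is `λ`-Einstein with `λ ≠ 0`.
(Here `e₁,…,e₈` are `b 0, …, b 7`.) -/
theorem statement16
    {H : Type*} [LieRing H] [LieAlgebra ℝ H] [Module.Finite ℝ H]
    (b : Basis (Fin 8) ℝ H)
    -- the non-vanishing brackets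
    (h12 : ⁅b 0, b 1⁆ = (-4 * Real.sqrt 3) • b 2)
    (h13 : ⁅b 0, b 2⁆ = Real.sqrt (5/2) • b 3)
    (h14 : ⁅b 0, b 3⁆ = (-2 * Real.sqrt 3) • b 7)
    (h15 : ⁅b 0, b 4⁆ = (3 * Real.sqrt (7/2)) • b 5)
    (h16 : ⁅b 0, b 5⁆ = (-4 * Real.sqrt 2) • b 6)
    (h23 : ⁅b 1, b 2⁆ = (- Real.sqrt (5/2)) • b 4)
    (h24 : ⁅b 1, b 3⁆ = (-3 * Real.sqrt (7/2)) • b 5)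
    (h25 : ⁅b 1, b 4⁆ = (-2 * Real.sqrt 3) • b 6)
    (h26 : ⁅b 1, b 5⁆ = (-4 * Real.sqrt 2) • b 7)
    (h34 : ⁅b 2, b 3⁆ = (- Real.sqrt 21) • b 6)
    (h35 : ⁅b 2, b 4⁆ = (- Real.sqrt 21) • b 7)
    -- all other brackets of basis vectors vanish
    (hrest : ∀ i j : Fin 8, i < j →
      (i, j) ∉ ({(0,1), (0,2), (0,3), (0,4), (0,5), (1,2), (1,3), (1,4), (1,5),
        (2,3), (2,4)} : Set (Fin 8 × Fin 8)) → ⁅b i, b j⁆ = 0)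
    -- the Lorentzian inner product making `b` orthonormal with `⟨e₆,e₆⟩ = −1`
    (B : H →ₗ[ℝ] H →ₗ[ℝ] ℝ)
    (hsymm : ∀ u v : H, B u v = B v u)
    (horth : ∀ i j : Fin 8, i ≠ j → B (b i) (b j) = 0)
    (htime : B (b 5) (b 5) = -1)
    (hspace : ∀ i : Fin 8, i ≠ 5 → B (b i) (b i) = 1)
    -- `adStar u` is the adjoint of `ad u` with respect to `B`
    (adStar : H → Module.End ℝ H)
    (hadStar : ∀ u v w : H, B (adStar u v) w = B v ⁅u, w⁆)
    -- `Jm u` is the skew-symmetric endomorphism `J_u(v) = ad_v*(u)`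
    (Jm : H → Module.End ℝ H)
    (hJm : ∀ u v w : H, B (Jm u v) w = B u ⁅v, w⁆) :
    -- `h` is nilpotent
    (∃ k, LieModule.lowerCentralSeries ℝ H H k = ⊥) ∧
    -- the center is `span{e₇, e₈}` ...
    (LieAlgebra.center ℝ H).toSubmodule = Submodule.span ℝ {b 6, b 7} ∧
    -- ... and is nondegenerate
    (∀ z ∈ LieAlgebra.center ℝ H,
      (∀ w ∈ LieAlgebra.center ℝ H, B z w = 0) → z = 0) ∧
    -- `(h, ⟨·,·⟩)` is `λ`-Einstein for some `λ ≠ 0`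
    (∃ lam : ℝ, lam ≠ 0 ∧ ∀ u v : H,
      -(1/2) * LinearMap.trace ℝ H ((LieAlgebra.ad ℝ H u : Module.End ℝ H) ∘ₗ adStar v)
        - (1/4) * LinearMap.trace ℝ H (Jm u ∘ₗ Jm v) = lam * B u v) := by
  have hzero (i j : Fin 8) (hij : i < j)
      (h : (i, j) ∉ ({(0,1), (0,2), (0,3), (0,4), (0,5), (1,2), (1,3), (1,4), (1,5),
        (2,3), (2,4)} : Finset (Fin 8 × Fin 8))) : ⁅b i, b j⁆ = 0 :=
    hrest i j hij (by simpa using h)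
  have hlie (u v : H) : ⁅u, v⁆ =
        ((-4 * √3) * (b.repr u 0 * b.repr v 1 - b.repr u 1 * b.repr v 0)) • b 2 +
        (√(5/2) * (b.repr u 0 * b.repr v 2 - b.repr u 2 * b.repr v 0)) • b 3 +
        ((-√(5/2)) * (b.repr u 1 * b.repr v 2 - b.repr u 2 * b.repr v 1)) • b 4 +
        ((3 * √(7/2)) * (b.repr u 0 * b.repr v 4 - b.repr u 4 * b.repr v 0) +
          (-3 * √(7/2)) * (b.repr u 1 * b.repr v 3 - b.repr u 3 * b.repr v 1)) • b 5 +
        ((-4 * √2) * (b.repr u 0 * b.repr v 5 - b.repr u 5 * b.repr v 0) +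
          (-2 * √3) * (b.repr u 1 * b.repr v 4 - b.repr u 4 * b.repr v 1) +
          (-√21) * (b.repr u 2 * b.repr v 3 - b.repr u 3 * b.repr v 2)) • b 6 +
        ((-2 * √3) * (b.repr u 0 * b.repr v 3 - b.repr u 3 * b.repr v 0) +
          (-4 * √2) * (b.repr u 1 * b.repr v 5 - b.repr u 5 * b.repr v 1) +
          (-√21) * (b.repr u 2 * b.repr v 4 - b.repr u 4 * b.repr v 2)) • b 7 := by
    conv_lhs => rw [← b.sum_repr u, ← b.sum_repr v]
    have hskew (i j : Fin 8) : ⁅b j, b i⁆ = -⁅b i, b j⁆ := (lie_skew _ _).symm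
    simp only [Fin.sum_univ_eight, add_lie, lie_add, smul_lie, lie_smul, lie_self]
    rw [hskew 0 1, hskew 0 2, hskew 0 3, hskew 0 4, hskew 0 5, hskew 0 6, hskew 0 7,
      hskew 1 2, hskew 1 3, hskew 1 4, hskew 1 5, hskew 1 6, hskew 1 7, hskew 2 3,
      hskew 2 4, hskew 2 5, hskew 2 6, hskew 2 7, hskew 3 4, hskew 3 5, hskew 3 6,
      hskew 3 7, hskew 4 5, hskew 4 6, hskew 4 7, hskew 5 6, hskew 5 7, hskew 6 7]
    rw [h12, h13, h14, h15, h16, h23, h24, h25, h26, h34, h35,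
      hzero 0 6 (by decide) (by decide), hzero 0 7 (by decide) (by decide),
      hzero 1 6 (by decide) (by decide), hzero 1 7 (by decide) (by decide),
      hzero 2 5 (by decide) (by decide), hzero 2 6 (by decide) (by decide),
      hzero 2 7 (by decide) (by decide), hzero 3 4 (by decide) (by decide),
      hzero 3 5 (by decide) (by decide), hzero 3 6 (by decide) (by decide),
      hzero 3 7 (by decide) (by decide), hzero 4 5 (by decide) (by decide),
      hzero 4 6 (by decide) (by decide), hzero 4 7 (by decide) (by decide),
      hzero 5 6 (by decide) (by decide), hzero 5 7 (by decide) (by decide),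
      hzero 6 7 (by decide) (by decide)]
    module
  have hrepr (u v : H) (i : Fin 8) : b.repr ⁅u, v⁆ i = ![0, 0,
      (-4 * √3) * (b.repr u 0 * b.repr v 1 - b.repr u 1 * b.repr v 0),
      √(5/2) * (b.repr u 0 * b.repr v 2 - b.repr u 2 * b.repr v 0),
      (-√(5/2)) * (b.repr u 1 * b.repr v 2 - b.repr u 2 * b.repr v 1),
      (3 * √(7/2)) * (b.repr u 0 * b.repr v 4 - b.repr u 4 * b.repr v 0) +
        (-3 * √(7/2)) * (b.repr u 1 * b.repr v 3 - b.repr u 3 * b.repr v 1),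
      (-4 * √2) * (b.repr u 0 * b.repr v 5 - b.repr u 5 * b.repr v 0) +
        (-2 * √3) * (b.repr u 1 * b.repr v 4 - b.repr u 4 * b.repr v 1) +
        (-√21) * (b.repr u 2 * b.repr v 3 - b.repr u 3 * b.repr v 2),
      (-2 * √3) * (b.repr u 0 * b.repr v 3 - b.repr u 3 * b.repr v 0) +
        (-4 * √2) * (b.repr u 1 * b.repr v 5 - b.repr u 5 * b.repr v 1) +
        (-√21) * (b.repr u 2 * b.repr v 4 - b.repr u 4 * b.repr v 2)] i := by
    rw [hlie u v]
    fin_cases i <;> simp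
  set ε : Fin 8 → ℝ := fun i => if i = 5 then -1 else 1 with hε_def
  have hB (i j : Fin 8) : B (b i) (b j) = if i = j then ε i else 0 := by
    by_cases hij : i = j
    · subst hij
      by_cases hi : i = 5
      · simp [hε_def, hi, htime]
      · simp [hε_def, hi, hspace i hi]
    · simp [hij, horth i j hij]
  have hε (i : Fin 8) : ε i * ε i = 1 := by
    by_cases hi : i = 5 <;> simp [hε_def, hi]
  have hcenter : (LieAlgebra.center ℝ H).toSubmodule = Submodule.span ℝ {b 6, b 7} := by
    ext z
    rw [LieSubmodule.mem_toSubmodule, LieModule.mem_maxTrivSubmodule, Submodule.mem_span_pair]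
    constructor
    · intro hz
      have h0 (i : Fin 8) : b.repr ⁅b 0, z⁆ i = 0 := by simp [hz]
      have h1 (i : Fin 8) : b.repr ⁅b 1, z⁆ i = 0 := by simp [hz]
      have z0 : b.repr z 0 = 0 := by simpa [hrepr, Finsupp.single_apply] using h1 2
      have z1 : b.repr z 1 = 0 := by simpa [hrepr, Finsupp.single_apply] using h0 2
      have z2 : b.repr z 2 = 0 := by simpa [hrepr, Finsupp.single_apply] using h0 3
      have z3 : b.repr z 3 = 0 := by simpa [hrepr, Finsupp.single_apply] using h0 7
      have z4 : b.repr z 4 = 0 := by simpa [hrepr, Finsupp.single_apply] using h0 5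
      have z5 : b.repr z 5 = 0 := by simpa [hrepr, Finsupp.single_apply] using h0 6
      refine ⟨b.repr z 6, b.repr z 7, ?_⟩
      conv_rhs => rw [← b.sum_repr z]
      simp [-Basis.sum_repr, Fin.sum_univ_eight, z0, z1, z2, z3, z4, z5]
    · rintro ⟨α, β, rfl⟩ x
      simp [hlie]
  refine ⟨⟨8, lowerCentralSeries_eq_bot_of_repr_lie b fun u v i h => ?_⟩, hcenter, ?_, ?_⟩
  · rw [hrepr]
    fin_cases i <;> simp +decide [h]
  · intro z hz hzw
    have hmem (x : H) : x ∈ LieAlgebra.center ℝ H ↔ x ∈ Submodule.span ℝ {b 6, b 7} := by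
      rw [← hcenter, LieSubmodule.mem_toSubmodule]
    have h6 := hzw (b 6) ((hmem _).2 (Submodule.subset_span (by simp)))
    have h7 := hzw (b 7) ((hmem _).2 (Submodule.subset_span (by simp)))
    obtain ⟨α, β, rfl⟩ := Submodule.mem_span_pair.1 ((hmem z).1 hz)
    simp [hB, hε_def] at h6 h7
    simp [h6, h7]
  · refine ⟨1 / 2, by norm_num, fun u v => ?_⟩
    have s3 : √3 ^ 2 = (3 : ℝ) := Real.sq_sqrt (by norm_num)
    have s5 : √(5 / 2) ^ 2 = (5 / 2 : ℝ) := Real.sq_sqrt (by norm_num)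
    have s7 : √(7 / 2) ^ 2 = (7 / 2 : ℝ) := Real.sq_sqrt (by norm_num)
    have s2 : √2 ^ 2 = (2 : ℝ) := Real.sq_sqrt (by norm_num)
    have s21 : √21 ^ 2 = (21 : ℝ) := Real.sq_sqrt (by norm_num)
    rw [trace_ad_comp_adjoint b B ε hB hε u v (adStar v) (hadStar v),
      trace_comp_of_bilin_lie b B ε hB hε u v (Jm u) (Jm v) (hJm u) (hJm v)]
    have hJ : ∑ i, ∑ j, ε i * ε j * B u ⁅b i, b j⁆ * B v ⁅b i, b j⁆ =
        96 * (b.repr u 2 * b.repr v 2) + 5 * (b.repr u 3 * b.repr v 3) +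
          5 * (b.repr u 4 * b.repr v 4) +
          126 * (b.repr u 5 * b.repr v 5) + 2 * (b.repr u 6 * b.repr v 6) +
          2 * (b.repr u 7 * b.repr v 7) := by
      simp only [Fin.sum_univ_eight, hlie (b _), map_add, map_smul,
        bilin_basis_right_of_orthogonal b B ε hB]
      simp [hε_def, -Real.sqrt_div, -Real.sqrt_div']
      ring_nf
      simp only [s3, s5, s7, s2, s21]
      ring
    have had : ∑ i, ε i * B ⁅u, b i⁆ ⁅v, b i⁆ =
        -(b.repr u 0 * b.repr v 0) - b.repr u 1 * b.repr v 1 + 47 * (b.repr u 2 * b.repr v 2) +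
          3 / 2 * (b.repr u 3 * b.repr v 3) + 3 / 2 * (b.repr u 4 * b.repr v 4) +
          64 * (b.repr u 5 * b.repr v 5) := by
      simp only [bilin_eq_sum_repr_of_orthogonal b B ε hB, Fin.sum_univ_eight, hrepr]
      simp [hε_def, -Real.sqrt_div, -Real.sqrt_div']
      ring_nf
      simp only [s3, s5, s7, s2, s21]
      ring
    rw [had, hJ, bilin_eq_sum_repr_of_orthogonal b B ε hB]
    simp [Fin.sum_univ_eight, hε_def]
    ring
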